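/- Let m ≥ 5 be odd and let f : GF(2^m) → 𝔽_2 be balanced, semi-bent, and quadratic (all derivatives affine). Let T = {α ∈ GF(2^m) : Ŵ_f(α) = 0}, and let E be an 𝔽_2-linear subspace of GF(2^m) of dimension m−1 with E ≠ T and E^⊥ = {0, w}. For t ∈ ℤ define N_f(E,t) = |{a ∈ E : Ŵ_f(a) = t}|. Then N_f(E,0) = 2^{m−2}, N_f(E, 2^{(m+1)/2}) = 2^{m−3} + 2^{(m−3)/2}·(1 − f(0) − f(w)), and N_f(E, −2^{(m+1)/2}) = 2^{m−3} − 2^{(m−3)/2}·(1 − f(0) − f(w)), where f(0), f(w) ∈ {0,1} are regarded as integers. -/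

import Mathlib

open Finset
noncomputable section
open scoped Classical

/-- `GF n` is the finite field with `2^n` elements. -/
abbrev GF (n : ℕ) : Type := GaloisField 2 n

noncomputable instance (n : ℕ) : Fintype (GF n) := Fintype.ofFinite _

/-- The absolute trace map `GF n → 𝔽₂`. -/
def tr {n : ℕ} (x : GF n) : ZMod 2 := Algebra.trace (ZMod 2) (GF n) x

/-- The Walsh transform of a Boolean function `f : GF m → 𝔽₂` at `a`. -/
def walshB {m : ℕ} (f : GF m → ZMod 2) (a : GF m) : ℤ :=
  ∑ x : GF m, (-1 : ℤ) ^ (f x + tr (a * x)).val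

/-- `N_f(E,t)`: the number of `a ∈ E` with `Ŵ_f(a) = t`. -/
def NfE {m : ℕ} (f : GF m → ZMod 2) (E : Submodule (ZMod 2) (GF m)) (t : ℤ) : ℕ :=
  (univ.filter (fun a : GF m => a ∈ E ∧ walshB f a = t)).card

/-- The sign `(-1)^z` of `z : 𝔽₂`. -/
def signZ (z : ZMod 2) : ℤ := (-1 : ℤ) ^ z.val

theorem signZ_add (a b : ZMod 2) : signZ (a + b) = signZ a * signZ b := by
  revert a b; decide

theorem signZ_zero : signZ 0 = 1 := by decide

theorem signZ_of_ne_zero {z : ZMod 2} (h : z ≠ 0) : signZ z = -1 := by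
  revert z; decide

theorem signZ_eq_one_sub (z : ZMod 2) : signZ z = 1 - 2 * (z.val : ℤ) := by
  revert z; decide

theorem tr_add {n : ℕ} (x y : GF n) : tr (x + y) = tr x + tr y := by
  simp [tr]

theorem tr_zero {n : ℕ} : tr (0 : GF n) = 0 := by
  simp [tr]

theorem GF.card {m : ℕ} (hm : m ≠ 0) : Fintype.card (GF m) = 2 ^ m := by
  rw [← Nat.card_eq_fintype_card]
  exact GaloisField.card 2 m hm

/-- The elements of a subspace, as a finset. -/
def elems {m : ℕ} (E : Submodule (ZMod 2) (GF m)) : Finset (GF m) :=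
  univ.filter (· ∈ E)

theorem mem_elems {m : ℕ} {E : Submodule (ZMod 2) (GF m)} {a : GF m} :
    a ∈ elems E ↔ a ∈ E := by
  simp [elems]

theorem elems_top {m : ℕ} : elems (⊤ : Submodule (ZMod 2) (GF m)) = univ := by
  simp [elems]

theorem card_elems {m : ℕ} (E : Submodule (ZMod 2) (GF m)) :
    (elems E).card = 2 ^ Module.finrank (ZMod 2) E := by
  have h := Module.card_eq_pow_finrank (K := ZMod 2) (V := E)
  rw [ZMod.card] at h
  rw [← h, elems, Fintype.card_subtype]

/-- The trace-orthogonal complement, as a finset. -/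
def perp {m : ℕ} (E : Submodule (ZMod 2) (GF m)) : Finset (GF m) :=
  univ.filter (fun x => ∀ y ∈ E, tr (x * y) = 0)

theorem mem_perp {m : ℕ} {E : Submodule (ZMod 2) (GF m)} {x : GF m} :
    x ∈ perp E ↔ ∀ y ∈ E, tr (x * y) = 0 := by
  simp [perp]

theorem perp_top {m : ℕ} : perp (⊤ : Submodule (ZMod 2) (GF m)) = {0} := by
  ext x
  rw [mem_perp, mem_singleton]
  constructor
  · intro h
    refine (traceForm_nondegenerate (ZMod 2) (GF m)).1 x fun y => ?_
    exact h y Submodule.mem_top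
  · rintro rfl y -
    simp [tr_zero]

/-- Orthogonality of additive characters on a subspace. -/
theorem sum_signZ_tr {m : ℕ} (E : Submodule (ZMod 2) (GF m)) (x : GF m) :
    ∑ a ∈ elems E, signZ (tr (x * a)) = if x ∈ perp E then ((elems E).card : ℤ) else 0 := by
  split_ifs with h
  · rw [mem_perp] at h
    rw [sum_congr rfl fun a ha => by rw [h a (mem_elems.1 ha), signZ_zero]]
    simp
  · rw [mem_perp] at h
    push Not at h
    obtain ⟨b, hb, hxb⟩ := h
    have key : ∑ a ∈ elems E, signZ (tr (x * a)) = ∑ a ∈ elems E, signZ (tr (x * (a + b))) := by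
      refine (sum_bij' (fun a _ => a + b) (fun a _ => a - b) ?_ ?_ ?_ ?_ ?_).symm
      · exact fun a ha => mem_elems.2 (E.add_mem (mem_elems.1 ha) hb)
      · exact fun a ha => mem_elems.2 (E.sub_mem (mem_elems.1 ha) hb)
      · simp
      · simp
      · simp
    simp_rw [mul_add, tr_add, signZ_add, signZ_of_ne_zero hxb, mul_neg_one, sum_neg_distrib] at key
    linarith

theorem sum_univ_signZ_tr {m : ℕ} (x : GF m) :
    ∑ a : GF m, signZ (tr (x * a)) = if x = 0 then (Fintype.card (GF m) : ℤ) else 0 := by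
  have h := sum_signZ_tr (⊤ : Submodule (ZMod 2) (GF m)) x
  simpa [elems_top, perp_top] using h

theorem card_elems_mul_card_perp {m : ℕ} (E : Submodule (ZMod 2) (GF m)) :
    (elems E).card * (perp E).card = Fintype.card (GF m) := by
  have h : ∑ x : GF m, ∑ a ∈ elems E, signZ (tr (x * a)) =
      ∑ a ∈ elems E, ∑ x : GF m, signZ (tr (a * x)) := by
    rw [sum_comm]
    simp_rw [mul_comm]
  simp_rw [sum_signZ_tr, sum_univ_signZ_tr] at h
  have h0 : (0 : GF m) ∈ elems E := mem_elems.2 E.zero_mem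
  rw [sum_ite_mem, univ_inter, sum_const, sum_ite_eq' _ _ (fun _ => (Fintype.card (GF m) : ℤ)),
    if_pos h0, nsmul_eq_mul, mul_comm] at h
  exact_mod_cast h

theorem walshB_eq {m : ℕ} (f : GF m → ZMod 2) (a : GF m) :
    walshB f a = ∑ x : GF m, signZ (f x) * signZ (tr (x * a)) := by
  simp_rw [← signZ_add, mul_comm _ a]
  rfl

theorem sum_walshB {m : ℕ} (f : GF m → ZMod 2) (E : Submodule (ZMod 2) (GF m)) :
    ∑ a ∈ elems E, walshB f a = (elems E).card * ∑ d ∈ perp E, signZ (f d) := by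
  simp_rw [walshB_eq]
  rw [sum_comm]
  simp_rw [← mul_sum, sum_signZ_tr, mul_ite, mul_zero]
  rw [sum_ite_mem, univ_inter, ← sum_mul, mul_comm]

theorem sum_walshB_sq {m : ℕ} (f : GF m → ZMod 2) (E : Submodule (ZMod 2) (GF m)) :
    ∑ a ∈ elems E, walshB f a ^ 2 =
      (elems E).card * ∑ d ∈ perp E, ∑ x : GF m, signZ (f x + f (x + d)) := by
  have hW (a : GF m) : walshB f a ^ 2 =
      ∑ d : GF m, (∑ x : GF m, signZ (f x + f (x + d))) * signZ (tr (d * a)) := by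
    have hshift (x : GF m) : walshB f a =
        ∑ d : GF m, signZ (f (x + d)) * signZ (tr ((x + d) * a)) := by
      rw [walshB_eq]
      exact (Equiv.sum_comp (Equiv.addLeft x) fun y => signZ (f y) * signZ (tr (y * a))).symm
    rw [sq]
    nth_rw 1 [walshB_eq]
    rw [sum_mul]
    simp_rw [sum_mul]
    rw [sum_comm]
    refine sum_congr rfl fun x _ => ?_
    rw [hshift x, mul_sum]
    refine sum_congr rfl fun d _ => ?_
    have hsq : signZ (tr (x * a)) * signZ (tr (x * a)) = 1 := by
      generalize tr (x * a) = z
      revert z; decide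
    rw [add_mul, tr_add, signZ_add, signZ_add]
    linear_combination signZ (f x) * signZ (f (x + d)) * signZ (tr (d * a)) * hsq
  simp_rw [hW]
  rw [sum_comm]
  simp_rw [← mul_sum, sum_signZ_tr, mul_ite, mul_zero]
  rw [sum_ite_mem, univ_inter, ← sum_mul, mul_comm]

theorem sum_signZ_self {m : ℕ} (f : GF m → ZMod 2) :
    ∑ x : GF m, signZ (f x + f (x + 0)) = Fintype.card (GF m) := by
  have h (z : ZMod 2) : signZ (z + z) = 1 := by revert z; decide
  simp [h]

theorem parseval {m : ℕ} (f : GF m → ZMod 2) :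
    ∑ a : GF m, walshB f a ^ 2 = (Fintype.card (GF m) : ℤ) ^ 2 := by
  have h := sum_walshB_sq f ⊤
  rw [elems_top, perp_top, sum_singleton, sum_signZ_self, card_univ] at h
  rw [h, sq]

theorem NfE_eq {m : ℕ} (f : GF m → ZMod 2) (E : Submodule (ZMod 2) (GF m)) (t : ℤ) :
    NfE f E t = ((elems E).filter (fun a => walshB f a = t)).card := by
  rw [NfE, elems, filter_filter]

section SemiBent

variable {m : ℕ} {f : GF m → ZMod 2} {c : ℤ}

theorem NfE_add (hc : c ≠ 0) (hsb : ∀ a : GF m, walshB f a ∈ ({0, c, -c} : Set ℤ))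
    (E : Submodule (ZMod 2) (GF m)) :
    (NfE f E 0 : ℤ) + NfE f E c + NfE f E (-c) = (elems E).card := by
  simp_rw [NfE_eq, card_filter, card_eq_sum_ones]
  push_cast
  rw [← sum_add_distrib, ← sum_add_distrib]
  refine sum_congr rfl fun a _ => ?_
  rcases hsb a with h | h | h <;> rw [h] <;> split_ifs <;> first | rfl | (exfalso; omega)

theorem mul_NfE_sub (hc : c ≠ 0) (hsb : ∀ a : GF m, walshB f a ∈ ({0, c, -c} : Set ℤ))
    (E : Submodule (ZMod 2) (GF m)) :
    c * ((NfE f E c : ℤ) - NfE f E (-c)) = ∑ a ∈ elems E, walshB f a := by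
  simp_rw [NfE_eq, card_filter]
  push_cast
  rw [← sum_sub_distrib, mul_sum]
  refine sum_congr rfl fun a _ => ?_
  rcases hsb a with h | h | h <;> rw [h] <;> split_ifs <;> first | (exfalso; omega) | ring

theorem sq_mul_NfE_add (hc : c ≠ 0) (hsb : ∀ a : GF m, walshB f a ∈ ({0, c, -c} : Set ℤ))
    (E : Submodule (ZMod 2) (GF m)) :
    c ^ 2 * ((NfE f E c : ℤ) + NfE f E (-c)) = ∑ a ∈ elems E, walshB f a ^ 2 := by
  simp_rw [NfE_eq, card_filter]
  push_cast
  rw [← sum_add_distrib, mul_sum]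
  refine sum_congr rfl fun a _ => ?_
  rcases hsb a with h | h | h <;> rw [h] <;> split_ifs <;> first | (exfalso; omega) | ring

end SemiBent

theorem walshB_zero_of_balanced {m : ℕ} (hm : m ≠ 0) {f : GF m → ZMod 2}
    (hbal : (univ.filter (fun x : GF m => f x = 1)).card = 2 ^ (m - 1)) :
    walshB f 0 = 0 := by
  have h (z : ZMod 2) : signZ z = 1 - 2 * (if z = 1 then 1 else 0) := by revert z; decide
  have hcard : (((univ.filter (fun x : GF m => f x = 1)).card : ℕ) : ℤ) = 2 ^ (m - 1) := by
    exact_mod_cast hbal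
  rw [card_filter] at hcard
  push_cast at hcard
  rw [walshB_eq]
  simp_rw [mul_zero, tr_zero, signZ_zero, mul_one, h]
  rw [sum_sub_distrib, ← mul_sum, hcard, sum_const, card_univ, GF.card hm]
  obtain ⟨n, rfl⟩ := Nat.exists_eq_succ_of_ne_zero hm
  simp [pow_succ, mul_comm]

/-- The derivative of `f` in the direction `w` spanning `E^⊥` has zero sum when `E ≠ T`. -/
theorem sum_derivative_eq_zero {m k : ℕ} (hm : m = 2 * k + 1) {f : GF m → ZMod 2}
    (hbal : (univ.filter (fun x : GF m => f x = 1)).card = 2 ^ (m - 1))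
    (hsb : ∀ a : GF m, walshB f a ∈ ({0, 2 ^ (k + 1), -(2 ^ (k + 1))} : Set ℤ))
    {E : Submodule (ZMod 2) (GF m)} (hcE : (elems E).card = 2 ^ (2 * k))
    (hET : (E : Set (GF m)) ≠ {α : GF m | walshB f α = 0}) {w a : GF m} {ε : ZMod 2}
    (hsq : ∑ a ∈ elems E, walshB f a ^ 2 =
      (elems E).card * (2 ^ m + ∑ x : GF m, signZ (f x + f (x + w))))
    (hquad : ∀ x : GF m, f x + f (x + w) = tr (a * x) + ε) :
    ∑ x : GF m, signZ (f x + f (x + w)) = 0 := by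
  have hm0 : m ≠ 0 := by omega
  have hc : (2 ^ (k + 1) : ℤ) ≠ 0 := by positivity
  have hsum : ∑ x : GF m, signZ (f x + f (x + w)) =
      (if a = 0 then (2 ^ m : ℤ) else 0) * signZ ε := by
    simp_rw [hquad, signZ_add]
    rw [← sum_mul, sum_univ_signZ_tr, GF.card hm0]
    push_cast
    rfl
  by_cases ha : a = 0
  swap
  · rw [hsum, if_neg ha, zero_mul]
  exfalso
  rw [if_pos ha] at hsum
  rw [hsum, hcE] at hsq
  push_cast at hsq
  by_cases hε : ε = 0
  · rw [hε, signZ_zero] at hsq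
    have h1 := NfE_add hc hsb E
    have h2 := sq_mul_NfE_add hc hsb E
    rw [hsq] at h2
    rw [hcE] at h1
    push_cast at h1
    have h3 : (NfE f E (2 ^ (k + 1)) : ℤ) + NfE f E (-(2 ^ (k + 1))) = 2 ^ (2 * k) := by
      refine mul_left_cancel₀ (pow_ne_zero 2 hc) (h2.trans ?_)
      rw [hm]; ring
    have h4 : NfE f E 0 = 0 := by
      zify; linarith
    rw [NfE_eq, card_eq_zero] at h4
    have h5 : (0 : GF m) ∈ (elems E).filter (fun a => walshB f a = 0) :=
      mem_filter.2 ⟨mem_elems.2 E.zero_mem, walshB_zero_of_balanced hm0 hbal⟩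
    rw [h4] at h5
    exact notMem_empty _ h5
  · rw [signZ_of_ne_zero hε, mul_neg_one, add_neg_cancel, mul_zero,
      sum_eq_zero_iff_of_nonneg fun _ _ => sq_nonneg _] at hsq
    have hsub : elems E ⊆ univ.filter (fun a : GF m => walshB f a = 0) := fun x hx =>
      mem_filter.2 ⟨mem_univ _, pow_eq_zero_iff two_ne_zero |>.1 (hsq x hx)⟩
    have h1 := NfE_add hc hsb ⊤
    have h2 := sq_mul_NfE_add hc hsb ⊤
    rw [elems_top, parseval, GF.card hm0] at h2
    rw [elems_top, card_univ, GF.card hm0] at h1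
    push_cast at h1 h2
    have h3 : (NfE f ⊤ (2 ^ (k + 1)) : ℤ) + NfE f ⊤ (-(2 ^ (k + 1))) = 2 ^ (2 * k) := by
      refine mul_left_cancel₀ (pow_ne_zero 2 hc) (h2.trans ?_)
      rw [hm]; ring
    have h4 : NfE f ⊤ 0 = 2 ^ (2 * k) := by
      zify
      have : (2 : ℤ) ^ m = 2 * 2 ^ (2 * k) := by rw [hm]; ring
      linarith
    rw [NfE_eq, elems_top] at h4
    have heq := eq_of_subset_of_card_le hsub (by rw [hcE, h4])
    refine hET (Set.ext fun x => ?_)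
    have hx : x ∈ elems E ↔ x ∈ univ.filter (fun a : GF m => walshB f a = 0) := by rw [heq]
    simpa [mem_elems] using hx

/-- distribution of the Walsh transform of a balanced quadratic semi-bent
function `f` on `GF(2^m)`, `m = 2k+1 ≥ 5` odd, over a hyperplane `E ≠ T` with
`E^⊥ = {0, w}`. -/
theorem stmt11 (m k : ℕ) (hm : m = 2 * k + 1) (hm5 : 5 ≤ m)
    (f : GF m → ZMod 2)
    (hbal : (univ.filter (fun x : GF m => f x = 1)).card = 2 ^ (m - 1))
    (hsb : ∀ a : GF m, walshB f a ∈ ({0, 2 ^ (k + 1), -(2 ^ (k + 1))} : Set ℤ))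
    (hquad : ∀ b : GF m, ∃ (a : GF m) (ε : ZMod 2),
      ∀ x : GF m, f x + f (x + b) = tr (a * x) + ε)
    (E : Submodule (ZMod 2) (GF m))
    (hE : Module.finrank (ZMod 2) E = m - 1)
    (hET : (E : Set (GF m)) ≠ {α : GF m | walshB f α = 0})
    (w : GF m)
    (hw : {x : GF m | ∀ y ∈ E, tr (x * y) = 0} = {0, w}) :
    NfE f E 0 = 2 ^ (m - 2) ∧
    (NfE f E (2 ^ (k + 1)) : ℤ)
      = 2 ^ (m - 3) + 2 ^ (k - 1) * (1 - ((f 0).val : ℤ) - ((f w).val : ℤ)) ∧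
    (NfE f E (-(2 ^ (k + 1))) : ℤ)
      = 2 ^ (m - 3) - 2 ^ (k - 1) * (1 - ((f 0).val : ℤ) - ((f w).val : ℤ)) := by
  have hm0 : m ≠ 0 := by omega
  have hc : (2 ^ (k + 1) : ℤ) ≠ 0 := by positivity
  have hcE : (elems E).card = 2 ^ (2 * k) := by
    rw [card_elems, hE, hm, Nat.add_sub_cancel]
  have hperp : perp E = {0, w} := by
    ext x
    have hx : x ∈ {x : GF m | ∀ y ∈ E, tr (x * y) = 0} ↔ x ∈ ({0, w} : Set (GF m)) := by rw [hw]
    simpa [mem_perp] using hx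
  have hw0 : (0 : GF m) ≠ w := by
    rintro rfl
    have h := card_elems_mul_card_perp E
    rw [hperp, hcE, GF.card hm0, hm, pow_succ] at h
    simp at h
  have hS := sum_walshB f E
  have hsq := sum_walshB_sq f E
  rw [hperp, sum_pair hw0] at hS hsq
  rw [sum_signZ_self, GF.card hm0] at hsq
  push_cast at hsq
  obtain ⟨a, ε, hquad⟩ := hquad w
  rw [sum_derivative_eq_zero hm hbal hsb hcE hET hsq hquad, hcE] at hsq
  rw [hcE, signZ_eq_one_sub, signZ_eq_one_sub] at hS
  have h1 := NfE_add hc hsb E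
  have h2 := mul_NfE_sub hc hsb E
  have h3 := sq_mul_NfE_add hc hsb E
  rw [hS] at h2
  rw [hsq] at h3
  rw [hcE] at h1
  obtain ⟨j, rfl⟩ : ∃ j, k = j + 1 := ⟨k - 1, by omega⟩
  push_cast at h1 h2 h3
  have h4 : (NfE f E (2 ^ (j + 1 + 1)) : ℤ) - NfE f E (-(2 ^ (j + 1 + 1))) =
      2 ^ (j + 1) * (1 - ((f 0).val : ℤ) - ((f w).val : ℤ)) := by
    refine mul_left_cancel₀ hc (h2.trans ?_)
    ring
  have h5 : (NfE f E (2 ^ (j + 1 + 1)) : ℤ) + NfE f E (-(2 ^ (j + 1 + 1))) =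
      2 ^ (2 * j + 1) := by
    refine mul_left_cancel₀ (pow_ne_zero 2 hc) (h3.trans ?_)
    rw [hm]
    ring
  have e2 : m - 2 = 2 * j + 1 := by omega
  have e3 : m - 3 = 2 * j := by omega
  rw [e2, e3, Nat.add_sub_cancel]
  have p1 : (2 : ℤ) ^ (2 * (j + 1)) = 4 * 2 ^ (2 * j) := by ring
  have p2 : (2 : ℤ) ^ (2 * j + 1) = 2 * 2 ^ (2 * j) := by ring
  have p3 : (2 : ℤ) ^ (j + 1) = 2 * 2 ^ j := by ring
  rw [p3] at h4
  refine ⟨?_, by linarith, by linarith⟩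
  zify
  linarith
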